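/- arXiv:1602.06174 — 2 statements merged into one kernel-verified Lean document; each statement's English description precedes it below -/
import Mathlib

section
/- Let a, b be positive integers and consider the directed grid with vertex set {1, …, a} × {1, …, b} and edges from each vertex one step to the right and one step up (when the head is in the vertex set), augmented with an exit edge upward from each vertex of the top row {(j, b) : 1 ≤ j ≤ a} and an exit edge to the right from each vertex of the right column {(a, j) : 1 ≤ j ≤ b}. Let R be a finite set of requests, each specifying a distinct start vertex lying on the bottom row or the left column of the grid and a designated exit side (top or right). Then there exist pairwise edge-disjoint directed paths, one per request, where the path of each request starts at its start vertex and terminates by traversing an exit edge of its designated side, if and only if the number of requests designated to the top side is at most a and the number of requests designated to the right side is at most b. -/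
/-- A step of a directed path in the 2D grid: one step to the right or one step up. -/
def GridStep (u v : ℕ × ℕ) : Prop :=
  v = (u.1 + 1, u.2) ∨ v = (u.1, u.2 + 1)

/-- The (directed) edges of a path given as a list of vertices. -/
def pathEdges (L : List (ℕ × ℕ)) : List ((ℕ × ℕ) × (ℕ × ℕ)) := L.zip L.tail

/-- Membership in the `a × b` grid `{1, …, a} × {1, …, b}`. -/
def InGrid (a b : ℕ) (u : ℕ × ℕ) : Prop :=
  1 ≤ u.1 ∧ u.1 ≤ a ∧ 1 ≤ u.2 ∧ u.2 ≤ b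

/-- `L` is a crossbar routing path in the `a × b` grid for a request starting at
`src` with designated exit side `top` (`top = true` means the top side, `top = false`
means the right side): it is a directed monotone path that starts at `src`, stays in
the grid, and terminates by traversing an exit edge of the designated side (an upward
edge out of the top row, resp. a rightward edge out of the right column). -/
def CrossbarPath (a b : ℕ) (src : ℕ × ℕ) (top : Bool) (L : List (ℕ × ℕ)) : Prop :=
  L.Chain' GridStep ∧
  L.head? = some src ∧
  (∀ u ∈ L.dropLast, InGrid a b u) ∧
  (if top then ∃ j, 1 ≤ j ∧ j ≤ a ∧ L.getLast? = some (j, b + 1)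
   else ∃ j, 1 ≤ j ∧ j ≤ b ∧ L.getLast? = some (a + 1, j))

/-- The list of the vertices `f 0, …, f n`. -/
def walkList (f : ℕ → ℕ × ℕ) (n : ℕ) : List (ℕ × ℕ) := (List.range (n + 1)).map f

/-- From `s`, go `h` steps up and then keep going right. -/
def upRight (s : ℕ × ℕ) (h k : ℕ) : ℕ × ℕ := (s.1 + (k - h), s.2 + min k h)

/-- From `s`, go `w` steps to the right and then keep going up. -/
def rightUp (s : ℕ × ℕ) (w k : ℕ) : ℕ × ℕ := (s.1 + min k w, s.2 + (k - w))

theorem mem_pathEdges_walkList {f : ℕ → ℕ × ℕ} {n : ℕ} {e : (ℕ × ℕ) × (ℕ × ℕ)}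
    (he : e ∈ pathEdges (walkList f n)) : ∃ k < n, e = (f k, f (k + 1)) := by
  obtain ⟨k, hk, rfl⟩ := List.mem_iff_getElem.1 he
  simp only [pathEdges, walkList, List.length_zip, List.length_map, List.length_range,
    List.length_tail] at hk
  exact ⟨k, by omega, by simp [pathEdges, walkList]⟩

theorem crossbarPath_walkList {a b : ℕ} {s : ℕ × ℕ} {top : Bool} {f : ℕ → ℕ × ℕ} {n : ℕ}
    (hstep : ∀ k < n, GridStep (f k) (f (k + 1))) (h0 : f 0 = s)
    (hgrid : ∀ k < n, InGrid a b (f k))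
    (hexit : if top then ∃ j, 1 ≤ j ∧ j ≤ a ∧ f n = (j, b + 1)
      else ∃ j, 1 ≤ j ∧ j ≤ b ∧ f n = (a + 1, j)) :
    CrossbarPath a b s top (walkList f n) := by
  refine ⟨?_, ?_, ?_, ?_⟩
  · refine List.isChain_iff_getElem.2 fun k hk => ?_
    simp only [walkList, List.length_map, List.length_range] at hk
    simpa [walkList] using hstep k (by omega)
  · simp [walkList, List.range_succ_eq_map, h0]
  · intro u hu
    simp only [walkList, List.range_succ, List.map_append, List.map_cons, List.map_nil,
      List.dropLast_concat, List.mem_map, List.mem_range] at hu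
    obtain ⟨k, hk, rfl⟩ := hu
    exact hgrid k hk
  · simpa [walkList, List.range_succ] using hexit

/-- A path that starts inside the grid and ends outside of it traverses a final edge whose tail
is in the grid. -/
theorem exists_last_edge {a b : ℕ} {s v : ℕ × ℕ} {L : List (ℕ × ℕ)}
    (hchain : L.IsChain GridStep) (hhead : L.head? = some s)
    (hgrid : ∀ u ∈ L.dropLast, InGrid a b u) (hlast : L.getLast? = some v) (hsv : s ≠ v) :
    ∃ u, (u, v) ∈ pathEdges L ∧ GridStep u v ∧ InGrid a b u := by
  induction L generalizing s with
  | nil => simp at hhead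
  | cons x M ih =>
    obtain rfl : x = s := by simpa using hhead
    cases M with
    | nil => exact absurd (by simpa using hlast) hsv
    | cons y N =>
      rw [List.isChain_cons_cons] at hchain
      have hx : InGrid a b x := hgrid x (by simp)
      by_cases hyv : y = v
      · subst hyv
        exact ⟨x, by simp [pathEdges], hchain.1, hx⟩
      · obtain ⟨u, hu, huv⟩ := ih hchain.2 rfl
          (fun w hw => hgrid w (by simp only [List.dropLast_cons_cons, List.mem_cons]; exact Or.inr hw))
          (by simpa using hlast) hyv
        exact ⟨u, by simpa [pathEdges] using Or.inr hu, huv⟩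

theorem CrossbarPath.exists_top_edge {a b : ℕ} {s : ℕ × ℕ} {L : List (ℕ × ℕ)}
    (hL : CrossbarPath a b s true L) (hs : InGrid a b s) :
    ∃ j ∈ Finset.Icc 1 a, ((j, b), (j, b + 1)) ∈ pathEdges L := by
  obtain ⟨hchain, hhead, hgrid, hexit⟩ := hL
  obtain ⟨j, hj1, hja, hlast⟩ := by simpa using hexit
  obtain ⟨⟨u1, u2⟩, hu, hstep, hin⟩ := exists_last_edge hchain hhead hgrid hlast (by
    rintro rfl; simp [InGrid] at hs)
  refine ⟨j, Finset.mem_Icc.2 ⟨hj1, hja⟩, ?_⟩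
  simp only [GridStep, InGrid, Prod.mk.injEq] at hstep hin
  obtain ⟨rfl, rfl⟩ : u1 = j ∧ u2 = b := by omega
  exact hu

theorem CrossbarPath.exists_right_edge {a b : ℕ} {s : ℕ × ℕ} {L : List (ℕ × ℕ)}
    (hL : CrossbarPath a b s false L) (hs : InGrid a b s) :
    ∃ j ∈ Finset.Icc 1 b, ((a, j), (a + 1, j)) ∈ pathEdges L := by
  obtain ⟨hchain, hhead, hgrid, hexit⟩ := hL
  obtain ⟨j, hj1, hjb, hlast⟩ := by simpa using hexit
  obtain ⟨⟨u1, u2⟩, hu, hstep, hin⟩ := exists_last_edge hchain hhead hgrid hlast (by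
    rintro rfl; simp [InGrid] at hs)
  refine ⟨j, Finset.mem_Icc.2 ⟨hj1, hjb⟩, ?_⟩
  simp only [GridStep, InGrid, Prod.mk.injEq] at hstep hin
  obtain ⟨rfl, rfl⟩ : u1 = a ∧ u2 = j := by omega
  exact hu

/-- Edge-disjoint paths each containing an edge from a family indexed by `Icc 1 n` number
at most `n`. -/
theorem card_le_of_disjoint_edges {ι : Type} {s : Finset ι} {n : ℕ} {p : ι → List (ℕ × ℕ)}
    (hp : ∀ i j, i ≠ j → ∀ e, e ∈ pathEdges (p i) → e ∉ pathEdges (p j))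
    (edge : ℕ → (ℕ × ℕ) × (ℕ × ℕ))
    (h : ∀ i ∈ s, ∃ j ∈ Finset.Icc 1 n, edge j ∈ pathEdges (p i)) : s.card ≤ n := by
  choose! x hx hxe using h
  refine (Finset.card_le_card_of_injOn x hx fun i hi j hj hij => ?_).trans (by simp)
  by_contra hne
  exact hp i j hne _ (hxe i hi) (hij ▸ hxe j hj)

theorem Finset.exists_bijection_of_card_eq {S U : Finset ℕ} (h : S.card = U.card) :
    ∃ f g : ℕ → ℕ, (∀ x ∈ S, f x ∈ U ∧ g (f x) = x) ∧ (∀ y ∈ U, g y ∈ S ∧ f (g y) = y) := by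
  let φ : S ≃ U := Finset.equivOfCardEq h
  refine ⟨fun x => if hx : x ∈ S then φ ⟨x, hx⟩ else 0,
    fun y => if hy : y ∈ U then φ.symm ⟨y, hy⟩ else 0, fun x hx => ?_, fun y hy => ?_⟩
  · simp [hx]
  · simp [hy]

/-- Between the disjoint pairs `A, A'` and `B, B'` of subsets of `X` and `Y`, there are
equinumerous sets `S` and `U` containing `A` and `B` and avoiding `A'` and `B'`. -/
theorem Finset.exists_between_card_eq {X Y A A' B B' : Finset ℕ}
    (hA : A ⊆ X) (hA' : A' ⊆ X) (hAA' : Disjoint A A')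
    (hB : B ⊆ Y) (hB' : B' ⊆ Y) (hBB' : Disjoint B B')
    (h1 : A.card + B'.card ≤ Y.card) (h2 : A'.card + B.card ≤ X.card) :
    ∃ S U : Finset ℕ, A ⊆ S ∧ S ⊆ X \ A' ∧ B ⊆ U ∧ U ⊆ Y \ B' ∧ S.card = U.card := by
  have hAX : A ⊆ X \ A' := Finset.subset_sdiff.2 ⟨hA, hAA'⟩
  have hBY : B ⊆ Y \ B' := Finset.subset_sdiff.2 ⟨hB, hBB'⟩
  have hcA := Finset.card_le_card hAX
  have hcB := Finset.card_le_card hBY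
  rw [Finset.card_sdiff_of_subset hA'] at hcA
  rw [Finset.card_sdiff_of_subset hB'] at hcB
  obtain ⟨S, hAS, hSX, hS⟩ := Finset.exists_subsuperset_card_eq hAX
    (le_max_left A.card B.card) (by rw [Finset.card_sdiff_of_subset hA']; omega)
  obtain ⟨U, hBU, hUY, hU⟩ := Finset.exists_subsuperset_card_eq hBY
    (le_max_right A.card B.card) (by rw [Finset.card_sdiff_of_subset hB']; omega)
  exact ⟨S, U, hAS, hSX, hBU, hUY, hS.trans hU.symm⟩

theorem crossbarPath_rightUp {a b : ℕ} {s : ℕ × ℕ} {w : ℕ} (hs : InGrid a b s)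
    (hw : s.1 + w ≤ a) :
    CrossbarPath a b s true (walkList (rightUp s w) (w + (b + 1 - s.2))) := by
  simp only [InGrid] at hs
  refine crossbarPath_walkList (fun k hk => ?_) (by simp [rightUp]) (fun k hk => ?_) ?_
  · simp only [GridStep, rightUp, Prod.mk.injEq]; omega
  · simp only [InGrid, rightUp]; omega
  · simp only [if_true, rightUp, Prod.mk.injEq]
    exact ⟨s.1 + w, by omega, by omega, by omega, by omega⟩

theorem crossbarPath_upRight {a b : ℕ} {s : ℕ × ℕ} {h : ℕ} (hs : InGrid a b s)
    (hh : s.2 + h ≤ b) :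
    CrossbarPath a b s false (walkList (upRight s h) (h + (a + 1 - s.1))) := by
  simp only [InGrid] at hs
  refine crossbarPath_walkList (fun k hk => ?_) (by simp [upRight]) (fun k hk => ?_) ?_
  · simp only [GridStep, upRight, Prod.mk.injEq]; omega
  · simp only [InGrid, upRight]; omega
  · simp only [Bool.false_eq_true, if_false, upRight, Prod.mk.injEq]
    exact ⟨s.2 + h, by omega, by omega, by omega, by omega⟩

/-- An edge of `upRight` is vertical below the turn or horizontal beyond it. -/
theorem mem_pathEdges_upRight {s : ℕ × ℕ} {h n : ℕ} {e : (ℕ × ℕ) × (ℕ × ℕ)}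
    (he : e ∈ pathEdges (walkList (upRight s h) n)) :
    (e.2.1 = e.1.1 ∧ e.1.1 = s.1 ∧ s.2 ≤ e.1.2 ∧ e.1.2 < s.2 + h) ∨
      (e.2.1 = e.1.1 + 1 ∧ e.1.2 = s.2 + h ∧ s.1 ≤ e.1.1) := by
  obtain ⟨k, -, rfl⟩ := mem_pathEdges_walkList he
  simp only [upRight]; omega

/-- An edge of `rightUp` is horizontal before the turn or vertical beyond it. -/
theorem mem_pathEdges_rightUp {s : ℕ × ℕ} {w n : ℕ} {e : (ℕ × ℕ) × (ℕ × ℕ)}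
    (he : e ∈ pathEdges (walkList (rightUp s w) n)) :
    (e.2.1 = e.1.1 + 1 ∧ e.1.2 = s.2 ∧ s.1 ≤ e.1.1 ∧ e.1.1 < s.1 + w) ∨
      (e.2.1 = e.1.1 ∧ e.1.1 = s.1 + w ∧ s.2 ≤ e.1.2) := by
  obtain ⟨k, -, rfl⟩ := mem_pathEdges_walkList he
  simp only [rightUp]; omega

/-- **Crossbar routing.**  In the directed `a × b` grid with rightward and upward
unit-capacity edges, exit edges upward from the top row and rightward from the right
column, a finite set of requests with distinct start vertices on the bottom row or
left column, each with a designated exit side, can be routed along pairwise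
edge-disjoint paths (each terminating through an exit edge of its designated side)
if and only if at most `a` requests are designated to the top side and at most `b`
requests are designated to the right side. -/
theorem crossbar_routing
    (a b : ℕ) (ha : 0 < a) (hb : 0 < b)
    {ι : Type} [Fintype ι] [DecidableEq ι]
    (src : ι → ℕ × ℕ) (hinj : Function.Injective src)
    (hsrc : ∀ i, InGrid a b (src i) ∧ ((src i).2 = 1 ∨ (src i).1 = 1))
    (side : ι → Bool) :
    (∃ p : ι → List (ℕ × ℕ),
        (∀ i, CrossbarPath a b (src i) (side i) (p i)) ∧
        (∀ i j, i ≠ j → ∀ e, e ∈ pathEdges (p i) → e ∉ pathEdges (p j))) ↔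
      ((Finset.univ.filter fun i => side i = true).card ≤ a ∧
        (Finset.univ.filter fun i => side i = false).card ≤ b) := by
  constructor
  · rintro ⟨p, hp, hdisj⟩
    refine ⟨card_le_of_disjoint_edges hdisj (fun j => ((j, b), (j, b + 1))) fun i hi => ?_,
      card_le_of_disjoint_edges hdisj (fun j => ((a, j), (a + 1, j))) fun i hi => ?_⟩
    · have h := hp i
      rw [(Finset.mem_filter.1 hi).2] at h
      exact h.exists_top_edge (hsrc i).1
    · have h := hp i
      rw [(Finset.mem_filter.1 hi).2] at h
      exact h.exists_right_edge (hsrc i).1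
  · rintro ⟨hT, hR⟩
    let left (t : Bool) : Finset ι := {i | side i = t ∧ (src i).2 ≠ 1}
    let bottom (t : Bool) : Finset ι := {i | side i = t ∧ (src i).2 = 1}
    have hcount (t : Bool) : (left t).card + (bottom t).card =
        (Finset.univ.filter fun i => side i = t).card := by
      rw [add_comm, ← Finset.card_filter_add_card_filter_not
        (s := Finset.univ.filter fun i => side i = t) (fun i => (src i).2 = 1)]
      simp only [left, bottom, Finset.filter_filter, ne_eq]
    let rows (t : Bool) : Finset ℕ := (left t).image fun i => (src i).2
    let cols (t : Bool) : Finset ℕ := (bottom t).image fun i => (src i).1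
    have eq_left {i j : ι} (hi : (src i).2 ≠ 1) (hj : (src j).2 ≠ 1)
        (h : (src i).2 = (src j).2) : i = j := by
      refine hinj (Prod.ext ?_ h)
      rw [(hsrc i).2.resolve_left hi, (hsrc j).2.resolve_left hj]
    have eq_bottom {i j : ι} (hi : (src i).2 = 1) (hj : (src j).2 = 1)
        (h : (src i).1 = (src j).1) : i = j := hinj (Prod.ext h (hi.trans hj.symm))
    have hrows_card (t : Bool) : (rows t).card = (left t).card :=
      Finset.card_image_of_injOn fun i hi j hj h => by
        simp only [left, Finset.coe_filter, Finset.mem_univ, true_and, Set.mem_ofPred_eq] at hi hj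
        exact eq_left hi.2 hj.2 h
    have hcols_card (t : Bool) : (cols t).card = (bottom t).card :=
      Finset.card_image_of_injOn fun i hi j hj h => by
        simp only [bottom, Finset.coe_filter, Finset.mem_univ, true_and, Set.mem_ofPred_eq] at hi hj
        exact eq_bottom hi.2 hj.2 h
    have mem_rows {t : Bool} {y : ℕ} :
        y ∈ rows t ↔ ∃ i, (side i = t ∧ (src i).2 ≠ 1) ∧ (src i).2 = y := by
      simp [rows, left]
    have mem_cols {t : Bool} {x : ℕ} :
        x ∈ cols t ↔ ∃ i, (side i = t ∧ (src i).2 = 1) ∧ (src i).1 = x := by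
      simp [cols, bottom]
    have hrows_sub (t : Bool) : rows t ⊆ Finset.Icc 1 b := fun y hy => by
      obtain ⟨i, -, rfl⟩ := mem_rows.1 hy
      exact Finset.mem_Icc.2 (hsrc i).1.2.2
    have hcols_sub (t : Bool) : cols t ⊆ Finset.Icc 1 a := fun x hx => by
      obtain ⟨i, -, rfl⟩ := mem_cols.1 hx
      exact Finset.mem_Icc.2 ⟨(hsrc i).1.1, (hsrc i).1.2.1⟩
    have hrows_disj : Disjoint (rows true) (rows false) := by
      refine Finset.disjoint_left.2 fun y h1 h2 => ?_
      obtain ⟨i, hi, rfl⟩ := mem_rows.1 h1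
      obtain ⟨j, hj, hij⟩ := mem_rows.1 h2
      obtain rfl := eq_left hj.2 hi.2 hij
      exact absurd (hi.1.symm.trans hj.1) (by decide)
    have hcols_disj : Disjoint (cols false) (cols true) := by
      refine Finset.disjoint_left.2 fun y h1 h2 => ?_
      obtain ⟨i, hi, rfl⟩ := mem_cols.1 h1
      obtain ⟨j, hj, hij⟩ := mem_cols.1 h2
      obtain rfl := eq_bottom hj.2 hi.2 hij
      exact absurd (hi.1.symm.trans hj.1) (by decide)
    obtain ⟨S, U, hS, hS', hU, hU', hSU⟩ := Finset.exists_between_card_eq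
      (hrows_sub true) (hrows_sub false) hrows_disj (hcols_sub false) (hcols_sub true) hcols_disj
      (by rw [hrows_card, hcols_card, hcount, Nat.card_Icc]; simpa using hT)
      (by rw [hrows_card, hcols_card, hcount, Nat.card_Icc]; simpa using hR)
    obtain ⟨f, g, hf, hg⟩ := Finset.exists_bijection_of_card_eq hSU
    -- A top request from the left in row `y` turns in column `f y`, and a right request from
    -- the bottom in column `x` turns in row `g x`; all other requests go straight.
    let turn (i : ι) : ℕ × ℕ :=
      if side i = true then (if (src i).2 = 1 then (src i).1 else f (src i).2, (src i).2)
      else ((src i).1, if (src i).2 = 1 then g (src i).1 else (src i).2)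
    have turn_bottom_top {i : ι} (h : side i = true) (h1 : (src i).2 = 1) :
        turn i = src i ∧ (src i).1 ∉ U := by
      refine ⟨by simp [turn, h, h1, Prod.ext_iff], fun hi => ?_⟩
      exact (Finset.mem_sdiff.1 (hU' hi)).2 (mem_cols.2 ⟨i, ⟨h, h1⟩, rfl⟩)
    have turn_left_right {i : ι} (h : side i = false) (h1 : (src i).2 ≠ 1) :
        turn i = src i ∧ (src i).2 ∉ S := by
      refine ⟨by simp [turn, h, h1], fun hi => ?_⟩
      exact (Finset.mem_sdiff.1 (hS' hi)).2 (mem_rows.2 ⟨i, ⟨h, h1⟩, rfl⟩)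
    have turn_left_top {i : ι} (h : side i = true) (h1 : (src i).2 ≠ 1) :
        (turn i).2 = (src i).2 ∧ (turn i).1 ∈ U ∧ g (turn i).1 = (src i).2 := by
      have := hf _ (hS (mem_rows.2 ⟨i, ⟨h, h1⟩, rfl⟩))
      simpa [turn, h, h1] using this
    have turn_bottom_right {i : ι} (h : side i = false) (h1 : (src i).2 = 1) :
        (turn i).1 = (src i).1 ∧ (turn i).2 ∈ S ∧ f (turn i).2 = (src i).1 := by
      have := hg _ (hU (mem_cols.2 ⟨i, ⟨h, h1⟩, rfl⟩))
      simpa [turn, h, h1] using this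
    have hS1 {y : ℕ} (hy : y ∈ S) : 1 ≤ y ∧ y ≤ b :=
      Finset.mem_Icc.1 (Finset.mem_sdiff.1 (hS' hy)).1
    have hU1 {x : ℕ} (hx : x ∈ U) : 1 ≤ x ∧ x ≤ a :=
      Finset.mem_Icc.1 (Finset.mem_sdiff.1 (hU' hx)).1
    have top_turn {i : ι} (h : side i = true) :
        (turn i).2 = (src i).2 ∧ (src i).1 ≤ (turn i).1 ∧ (turn i).1 ≤ a := by
      have hi := hsrc i
      simp only [InGrid] at hi
      by_cases h1 : (src i).2 = 1
      · rw [(turn_bottom_top h h1).1]; omega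
      · have := turn_left_top h h1
        have := hU1 this.2.1
        omega
    have right_turn {i : ι} (h : side i = false) :
        (turn i).1 = (src i).1 ∧ (src i).2 ≤ (turn i).2 ∧ (turn i).2 ≤ b := by
      have hi := hsrc i
      simp only [InGrid] at hi
      by_cases h1 : (src i).2 = 1
      · have := turn_bottom_right h h1
        have := hS1 this.2.1
        omega
      · rw [(turn_left_right h h1).1]; omega
    let path (i : ι) : List (ℕ × ℕ) :=
      if side i = true then
        walkList (rightUp (src i) ((turn i).1 - (src i).1))
          ((turn i).1 - (src i).1 + (b + 1 - (src i).2))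
      else
        walkList (upRight (src i) ((turn i).2 - (src i).2))
          ((turn i).2 - (src i).2 + (a + 1 - (src i).1))
    have edge_top {i : ι} (h : side i = true) {e} (he : e ∈ pathEdges (path i)) :
        (e.2.1 = e.1.1 + 1 ∧ e.1.2 = (turn i).2 ∧ (src i).1 ≤ e.1.1 ∧ e.1.1 < (turn i).1) ∨
          (e.2.1 = e.1.1 ∧ e.1.1 = (turn i).1 ∧ (turn i).2 ≤ e.1.2) := by
      simp only [path, h, if_true] at he
      have := mem_pathEdges_rightUp he
      have := top_turn h
      omega
    have edge_right {i : ι} (h : side i = false) {e} (he : e ∈ pathEdges (path i)) :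
        (e.2.1 = e.1.1 ∧ e.1.1 = (turn i).1 ∧ (src i).2 ≤ e.1.2 ∧ e.1.2 < (turn i).2) ∨
          (e.2.1 = e.1.1 + 1 ∧ e.1.2 = (turn i).2 ∧ (turn i).1 ≤ e.1.1) := by
      simp only [path, h, Bool.false_eq_true, if_false] at he
      have := mem_pathEdges_upRight he
      have := right_turn h
      omega
    have disj_top {i j : ι} (hij : i ≠ j) (hi : side i = true) (hj : side j = true) {e}
        (hei : e ∈ pathEdges (path i)) (hej : e ∈ pathEdges (path j)) : False := by
      have hei := edge_top hi hei
      have hej := edge_top hj hej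
      by_cases h1 : (src i).2 = 1 <;> by_cases h2 : (src j).2 = 1
      · have ti := (turn_bottom_top hi h1).1
        have tj := (turn_bottom_top hj h2).1
        have : (src i).1 ≠ (src j).1 := fun h => hij (eq_bottom h1 h2 h)
        rw [ti] at hei
        rw [tj] at hej
        omega
      · have ti := turn_bottom_top hi h1
        have tj := turn_left_top hj h2
        have : (src i).1 ≠ (turn j).1 := fun h => ti.2 (h ▸ tj.2.1)
        rw [ti.1] at hei
        omega
      · have ti := turn_left_top hi h1
        have tj := turn_bottom_top hj h2
        have : (src j).1 ≠ (turn i).1 := fun h => tj.2 (h ▸ ti.2.1)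
        rw [tj.1] at hej
        omega
      · have ti := turn_left_top hi h1
        have tj := turn_left_top hj h2
        have hne : (src i).2 ≠ (src j).2 := fun h => hij (eq_left h1 h2 h)
        have : (turn i).1 ≠ (turn j).1 := fun h => hne (by rw [← ti.2.2, ← tj.2.2, h])
        omega
    have disj_right {i j : ι} (hij : i ≠ j) (hi : side i = false) (hj : side j = false) {e}
        (hei : e ∈ pathEdges (path i)) (hej : e ∈ pathEdges (path j)) : False := by
      have hei := edge_right hi hei
      have hej := edge_right hj hej
      by_cases h1 : (src i).2 = 1 <;> by_cases h2 : (src j).2 = 1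
      · have ti := turn_bottom_right hi h1
        have tj := turn_bottom_right hj h2
        have hne : (src i).1 ≠ (src j).1 := fun h => hij (eq_bottom h1 h2 h)
        have : (turn i).2 ≠ (turn j).2 := fun h => hne (by rw [← ti.2.2, ← tj.2.2, h])
        omega
      · have ti := turn_bottom_right hi h1
        have tj := turn_left_right hj h2
        have : (src j).2 ≠ (turn i).2 := fun h => tj.2 (h ▸ ti.2.1)
        rw [tj.1] at hej
        omega
      · have ti := turn_left_right hi h1
        have tj := turn_bottom_right hj h2
        have : (src i).2 ≠ (turn j).2 := fun h => ti.2 (h ▸ tj.2.1)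
        rw [ti.1] at hei
        omega
      · have ti := (turn_left_right hi h1).1
        have tj := (turn_left_right hj h2).1
        have : (src i).2 ≠ (src j).2 := fun h => hij (eq_left h1 h2 h)
        rw [ti] at hei
        rw [tj] at hej
        omega
    have disj_top_right {i j : ι} (hi : side i = true) (hj : side j = false) {e}
        (hei : e ∈ pathEdges (path i)) (hej : e ∈ pathEdges (path j)) : False := by
      have hei := edge_top hi hei
      have hej := edge_right hj hej
      by_cases h1 : (src i).2 = 1 <;> by_cases h2 : (src j).2 = 1
      · have ti := turn_bottom_top hi h1
        have tj := turn_bottom_right hj h2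
        have : (src i).1 ≠ (src j).1 := fun h => by
          obtain rfl := eq_bottom h1 h2 h
          exact absurd (hi.symm.trans hj) (by decide)
        rw [ti.1] at hei
        omega
      · rw [(turn_bottom_top hi h1).1] at hei
        rw [(turn_left_right hj h2).1] at hej
        omega
      · have ti := turn_left_top hi h1
        have tj := turn_bottom_right hj h2
        have hrow : (turn i).2 = (turn j).2 → (turn i).1 = (turn j).1 := fun h => by
          rw [tj.1, ← tj.2.2, ← h, ti.1, ← ti.2.2, (hg _ ti.2.1).2]
        have hcol : (turn i).1 = (turn j).1 → (turn i).2 = (turn j).2 := fun h => by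
          rw [ti.1, ← ti.2.2, h, tj.1, ← tj.2.2, (hf _ tj.2.1).2]
        omega
      · have ti := turn_left_top hi h1
        have tj := turn_left_right hj h2
        have : (src i).2 ≠ (src j).2 := fun h => by
          obtain rfl := eq_left h1 h2 h
          exact absurd (hi.symm.trans hj) (by decide)
        rw [tj.1] at hej
        omega
    refine ⟨path, fun i => ?_, fun i j hij e hei hej => ?_⟩
    · cases h : side i
      · have := right_turn h
        simp only [path, h, Bool.false_eq_true, if_false]
        exact crossbarPath_upRight (hsrc i).1 (by omega)
      · have := top_turn h
        simp only [path, h, if_true]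
        exact crossbarPath_rightUp (hsrc i).1 (by omega)
    · cases hi : side i <;> cases hj : side j
      · exact disj_right hij hi hj hei hej
      · exact disj_top_right hj hi hej hei
      · exact disj_top_right hi hj hei hej
      · exact disj_top hij hi hj hei hej
end

section
/- Let m be a positive integer and let Q = {1, …, m} × {1, …, m} be a quadrant of the directed grid, with unit-capacity edges from each vertex of Q one step right and one step up (when the head is in Q), augmented with a unit-capacity exit edge upward from each vertex of the top row of Q and a unit-capacity exit edge rightward from each vertex of the right column of Q. Let X be a finite family of requests, each specifying a source vertex in Q (several requests may share a source). Then there exist pairwise edge-disjoint directed paths, one per request, each starting at the request's source and terminating by traversing an exit edge (so reaching the top or right side of Q), if and only if for every axis-parallel rectangle Z ⊆ Q of width x and height y, the number of requests with source in Z is at most x + y. -/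
/-- Membership in the quadrant `Q = {1, …, m} × {1, …, m}`. -/
def InQuad (m : ℕ) (u : ℕ × ℕ) : Prop :=
  1 ≤ u.1 ∧ u.1 ≤ m ∧ 1 ≤ u.2 ∧ u.2 ≤ m

/-- `L` is a path in the quadrant `Q = {1, …, m} × {1, …, m}` for a request with
source `src ∈ Q`: a directed monotone path starting at `src`, staying in `Q`, that
terminates by traversing an exit edge, i.e. an upward edge out of the top row or a
rightward edge out of the right column of `Q`. -/
def QuadPath (m : ℕ) (src : ℕ × ℕ) (L : List (ℕ × ℕ)) : Prop :=
  L.Chain' GridStep ∧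
  L.head? = some src ∧
  (∀ u ∈ L.dropLast, InQuad m u) ∧
  (∃ j, 1 ≤ j ∧ j ≤ m ∧
    (L.getLast? = some (j, m + 1) ∨ L.getLast? = some (m + 1, j)))

/-- The two edges of the infinite grid leaving the vertex `u`. -/
def outEdges (u : ℕ × ℕ) : Finset ((ℕ × ℕ) × (ℕ × ℕ)) :=
  {(u, (u.1 + 1, u.2)), (u, (u.1, u.2 + 1))}

theorem mem_outEdges {u : ℕ × ℕ} {e : (ℕ × ℕ) × (ℕ × ℕ)} :
    e ∈ outEdges u ↔ e.1 = u ∧ GridStep e.1 e.2 := by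
  obtain ⟨a, b⟩ := e
  simp only [outEdges, GridStep, Finset.mem_insert, Finset.mem_singleton, Prod.mk.injEq]
  constructor
  · rintro (⟨rfl, h⟩ | ⟨rfl, h⟩)
    · exact ⟨rfl, Or.inl h⟩
    · exact ⟨rfl, Or.inr h⟩
  · rintro ⟨rfl, h | h⟩
    · exact Or.inl ⟨rfl, h⟩
    · exact Or.inr ⟨rfl, h⟩

/-- The grid edges leaving the vertex set `W`. -/
def cutEdges (W : Finset (ℕ × ℕ)) : Finset ((ℕ × ℕ) × (ℕ × ℕ)) :=
  (W.biUnion outEdges).filter fun e => e.2 ∉ W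

theorem mem_cutEdges {W : Finset (ℕ × ℕ)} {e : (ℕ × ℕ) × (ℕ × ℕ)} :
    e ∈ cutEdges W ↔ e.1 ∈ W ∧ GridStep e.1 e.2 ∧ e.2 ∉ W := by
  simp only [cutEdges, Finset.mem_filter, Finset.mem_biUnion, mem_outEdges]
  constructor
  · rintro ⟨⟨u, hu, rfl, h⟩, h'⟩
    exact ⟨hu, h, h'⟩
  · rintro ⟨hu, h, h'⟩
    exact ⟨⟨_, hu, rfl, h⟩, h'⟩

/-- Every column and every row met by `W` contributes an edge leaving `W`. -/
theorem card_columns_add_card_rows_le_card_cutEdges (W : Finset (ℕ × ℕ)) :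
    (W.image Prod.fst).card + (W.image Prod.snd).card ≤ (cutEdges W).card := by
  rw [← Finset.card_filter_add_card_filter_not (s := cutEdges W) (fun e => e.1.1 = e.2.1)]
  refine add_le_add
    ((Finset.card_le_card ?_).trans (Finset.card_image_le (f := fun e => e.1.1)))
    ((Finset.card_le_card ?_).trans (Finset.card_image_le (f := fun e => e.1.2)))
  · intro c hc
    obtain ⟨u, hu, rfl⟩ := Finset.mem_image.1 hc
    obtain ⟨v, hv, hmax⟩ := Finset.exists_max_image (W.filter fun w => w.1 = u.1) Prod.snd
      ⟨u, by simp [hu]⟩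
    rw [Finset.mem_filter] at hv
    refine Finset.mem_image.2 ⟨(v, (v.1, v.2 + 1)), ?_, hv.2⟩
    refine Finset.mem_filter.2 ⟨mem_cutEdges.2 ⟨hv.1, Or.inr rfl, fun h => ?_⟩, rfl⟩
    have := hmax (v.1, v.2 + 1) (Finset.mem_filter.2 ⟨h, hv.2⟩)
    simp at this
  · intro c hc
    obtain ⟨u, hu, rfl⟩ := Finset.mem_image.1 hc
    obtain ⟨v, hv, hmax⟩ := Finset.exists_max_image (W.filter fun w => w.2 = u.2) Prod.fst
      ⟨u, by simp [hu]⟩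
    rw [Finset.mem_filter] at hv
    refine Finset.mem_image.2 ⟨(v, (v.1 + 1, v.2)), ?_, hv.2⟩
    refine Finset.mem_filter.2 ⟨mem_cutEdges.2 ⟨hv.1, Or.inl rfl, fun h => ?_⟩, by simp⟩
    have := hmax (v.1 + 1, v.2) (Finset.mem_filter.2 ⟨h, hv.2⟩)
    simp at this

/-- If no grid edge inside `W` joins `W ∩ P` and `W \ P`, the cuts of the two parts are
disjoint parts of the cut of `W`. -/
theorem card_cutEdges_filter_add_le {W : Finset (ℕ × ℕ)} (P : ℕ × ℕ → Prop) [DecidablePred P]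
    (hP : ∀ u ∈ W, ∀ v ∈ W, GridStep u v → (P u ↔ P v)) :
    (cutEdges (W.filter P)).card + (cutEdges (W.filter fun u => ¬ P u)).card ≤
      (cutEdges W).card := by
  rw [← Finset.card_filter_add_card_filter_not (s := cutEdges W) (fun e => P e.1)]
  refine add_le_add (Finset.card_le_card ?_) (Finset.card_le_card ?_) <;>
  · intro e he
    rw [mem_cutEdges] at he
    simp only [Finset.mem_filter, mem_cutEdges] at he ⊢
    have := hP e.1 he.1.1 e.2
    tauto

/-- The cut condition for rectangles implies the cut condition for all finite vertex sets. -/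
theorem demand_le_card_cutEdges {ι : Type*} [Fintype ι] (src : ι → ℕ × ℕ)
    (hrect : ∀ x₁ x₂ y₁ y₂ : ℕ, x₁ ≤ x₂ → y₁ ≤ y₂ →
      (Finset.univ.filter fun i =>
        x₁ ≤ (src i).1 ∧ (src i).1 ≤ x₂ ∧ y₁ ≤ (src i).2 ∧ (src i).2 ≤ y₂).card ≤
          (x₂ - x₁ + 1) + (y₂ - y₁ + 1)) (W : Finset (ℕ × ℕ)) :
    (Finset.univ.filter fun i => src i ∈ W).card ≤ (cutEdges W).card := by
  induction W using Finset.strongInduction with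
  | H W ih =>
    have split : ∀ P : ℕ × ℕ → Prop, DecidablePred P →
        (∀ u ∈ W, ∀ v ∈ W, GridStep u v → (P u ↔ P v)) →
        (∃ u ∈ W, P u) → (∃ u ∈ W, ¬ P u) →
        (Finset.univ.filter fun i => src i ∈ W).card ≤ (cutEdges W).card := by
      intro P _ hP ⟨u, hu, hPu⟩ ⟨v, hv, hPv⟩
      have h₁ := ih (W.filter P) (Finset.filter_ssubset.2 ⟨v, hv, hPv⟩)
      have h₂ := ih (W.filter fun u => ¬ P u)
        (Finset.filter_ssubset.2 ⟨u, hu, not_not.2 hPu⟩)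
      have h₃ := card_cutEdges_filter_add_le P hP
      rw [← Finset.card_filter_add_card_filter_not
        (s := Finset.univ.filter fun i => src i ∈ W) (fun i => P (src i))]
      simp only [Finset.mem_filter, Finset.filter_filter] at h₁ h₂ ⊢
      omega
    rcases W.eq_empty_or_nonempty with rfl | hne
    · simp
    obtain ⟨l, hl, hlmin⟩ := Finset.exists_min_image W Prod.fst hne
    obtain ⟨r, hr, hrmax⟩ := Finset.exists_max_image W Prod.fst hne
    obtain ⟨b, hb, hbmin⟩ := Finset.exists_min_image W Prod.snd hne
    obtain ⟨t, ht, htmax⟩ := Finset.exists_max_image W Prod.snd hne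
    by_cases hcol : Finset.Icc l.1 r.1 ⊆ W.image Prod.fst
    swap
    · obtain ⟨c, hc, hcW⟩ := Finset.not_subset.1 hcol
      rw [Finset.mem_Icc] at hc
      have hne : ∀ u ∈ W, u.1 ≠ c := fun u hu h => hcW (Finset.mem_image.2 ⟨u, hu, h⟩)
      refine split (fun u => u.1 < c) inferInstance ?_ ⟨l, hl, ?_⟩ ⟨r, hr, ?_⟩
      · rintro u hu v hv (rfl | rfl)
        · have h₁ := hne _ hu
          have h₂ := hne _ hv
          simp only at h₂ ⊢
          omega
        · rfl
      · exact lt_of_le_of_ne hc.1 (hne l hl)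
      · exact not_lt.2 hc.2
    by_cases hrow : Finset.Icc b.2 t.2 ⊆ W.image Prod.snd
    swap
    · obtain ⟨c, hc, hcW⟩ := Finset.not_subset.1 hrow
      rw [Finset.mem_Icc] at hc
      have hne : ∀ u ∈ W, u.2 ≠ c := fun u hu h => hcW (Finset.mem_image.2 ⟨u, hu, h⟩)
      refine split (fun u => u.2 < c) inferInstance ?_ ⟨b, hb, ?_⟩ ⟨t, ht, ?_⟩
      · rintro u hu v hv (rfl | rfl)
        · rfl
        · have h₁ := hne _ hu
          have h₂ := hne _ hv
          simp only at h₂ ⊢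
          omega
      · exact lt_of_le_of_ne hc.1 (hne b hb)
      · exact not_lt.2 hc.2
    have hcol' := Finset.card_le_card hcol
    have hrow' := Finset.card_le_card hrow
    rw [Nat.card_Icc] at hcol' hrow'
    have hlr := hlmin r hr
    have hbt := hbmin t ht
    have hcap := hrect l.1 r.1 b.2 t.2 hlr hbt
    have hsub : (Finset.univ.filter fun i => src i ∈ W).card ≤
        (Finset.univ.filter fun i =>
          l.1 ≤ (src i).1 ∧ (src i).1 ≤ r.1 ∧ b.2 ≤ (src i).2 ∧ (src i).2 ≤ t.2).card :=
      Finset.card_le_card fun i hi => by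
        have hi' := (Finset.mem_filter.1 hi).2
        exact Finset.mem_filter.2 ⟨Finset.mem_univ i,
          hlmin _ hi', hrmax _ hi', hbmin _ hi', htmax _ hi'⟩
    have := card_columns_add_card_rows_le_card_cutEdges W
    omega

/-- Under the cut condition, the sources start pairwise edge-disjoint infinite grid walks. -/
theorem exists_disjoint_walks {ι : Type*} [Fintype ι] (src : ι → ℕ × ℕ)
    (hcut : ∀ W : Finset (ℕ × ℕ),
      (Finset.univ.filter fun i => src i ∈ W).card ≤ (cutEdges W).card) :
    ∃ v : ι → ℕ → ℕ × ℕ, (∀ i, v i 0 = src i) ∧ (∀ i k, GridStep (v i k) (v i (k + 1))) ∧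
      ∀ i j k l, v i k = v j l → v i (k + 1) = v j (l + 1) → i = j := by
  classical
  let t : ι ⊕ ((ℕ × ℕ) × (ℕ × ℕ)) → Finset ((ℕ × ℕ) × (ℕ × ℕ)) :=
    Sum.elim (fun i => outEdges (src i)) (fun e => insert e (outEdges e.2))
  have hall : ∀ s : Finset (ι ⊕ ((ℕ × ℕ) × (ℕ × ℕ))), s.card ≤ (s.biUnion t).card := by
    intro s
    set W := s.toLeft.image src ∪ s.toRight.image Prod.snd with hW
    have hdem : s.toLeft.card ≤ (cutEdges W).card :=
      (Finset.card_le_card fun i hi => Finset.mem_filter.2 ⟨Finset.mem_univ i,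
        Finset.mem_union_left _ (Finset.mem_image_of_mem src hi)⟩).trans (hcut W)
    have hdisj : Disjoint (cutEdges W) s.toRight := by
      rw [Finset.disjoint_left]
      intro e he he'
      exact (mem_cutEdges.1 he).2.2
        (Finset.mem_union_right _ (Finset.mem_image_of_mem Prod.snd he'))
    have hsub : cutEdges W ∪ s.toRight ⊆ s.biUnion t := by
      intro e he
      rw [Finset.mem_biUnion]
      rcases Finset.mem_union.1 he with he | he
      · obtain ⟨h₁, h₂, -⟩ := mem_cutEdges.1 he
        rcases Finset.mem_union.1 h₁ with h | h
        · obtain ⟨i, hi, hie⟩ := Finset.mem_image.1 h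
          exact ⟨Sum.inl i, Finset.mem_toLeft.1 hi, mem_outEdges.2 ⟨hie.symm, h₂⟩⟩
        · obtain ⟨d, hd, hde⟩ := Finset.mem_image.1 h
          exact ⟨Sum.inr d, Finset.mem_toRight.1 hd,
            Finset.mem_insert_of_mem (mem_outEdges.2 ⟨hde.symm, h₂⟩)⟩
      · exact ⟨Sum.inr e, Finset.mem_toRight.1 he, Finset.mem_insert_self _ _⟩
    calc s.card = s.toLeft.card + s.toRight.card := Finset.card_toLeft_add_card_toRight.symm
      _ ≤ (cutEdges W).card + s.toRight.card := by gcongr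
      _ = (cutEdges W ∪ s.toRight).card := (Finset.card_union_of_disjoint hdisj).symm
      _ ≤ _ := Finset.card_le_card hsub
  obtain ⟨f, hf, hft⟩ := (Finset.all_card_le_biUnion_card_iff_exists_injective t).1 hall
  let g : ι → ℕ → (ℕ × ℕ) × (ℕ × ℕ) :=
    fun i k => Nat.rec (f (Sum.inl i)) (fun _ e => f (Sum.inr e)) k
  have hne : ∀ i k, g i (k + 1) ≠ g i k := by
    intro i k
    induction k with
    | zero => exact fun h => nomatch hf h
    | succ k ih => exact fun h => ih (Sum.inr_injective (hf h))
  have hnext : ∀ i k, g i (k + 1) ∈ outEdges (g i k).2 := fun i k =>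
    (Finset.mem_insert.1 (hft (Sum.inr (g i k)))).resolve_left (hne i k)
  have hstart : ∀ i, g i 0 ∈ outEdges (src i) := fun i => hft (Sum.inl i)
  have hinj : ∀ i j k l, g i k = g j l → i = j := by
    intro i j k
    induction k with
    | zero =>
      rintro (_ | l) h
      · exact Sum.inl_injective (hf h)
      · exact nomatch hf h
    | succ k ih =>
      rintro (_ | l) h
      · exact nomatch hf h
      · exact ih l (Sum.inr_injective (hf h))
  have hsnd : ∀ i k, (g i (k + 1)).1 = (g i k).2 := fun i k => (mem_outEdges.1 (hnext i k)).1
  refine ⟨fun i k => (g i k).1, fun i => (mem_outEdges.1 (hstart i)).1, fun i k => ?_,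
    fun i j k l h h' => hinj i j k l (Prod.ext h ?_)⟩
  · simp only [hsnd]
    cases k with
    | zero => exact (mem_outEdges.1 (hstart i)).2
    | succ k => exact (mem_outEdges.1 (hnext i k)).2
  · simpa only [hsnd] using h'

/-- An infinite grid walk from a vertex of the quadrant has an initial segment that is a
quadrant path. -/
theorem exists_quadPath_of_walk {m : ℕ} (v : ℕ → ℕ × ℕ) (h₀ : InQuad m (v 0))
    (hstep : ∀ k, GridStep (v k) (v (k + 1))) :
    ∃ n, QuadPath m (v 0) ((List.range n).map v) := by
  classical
  have hsum : ∀ k, k ≤ (v k).1 + (v k).2 := by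
    intro k
    induction k with
    | zero => exact Nat.zero_le _
    | succ k ih => rcases hstep k with h | h <;> rw [h] <;> simp only <;> omega
  have hex : ∃ k, ¬ InQuad m (v k) := by
    refine ⟨2 * m + 1, fun h => ?_⟩
    have := hsum (2 * m + 1)
    unfold InQuad at h
    omega
  obtain ⟨n, hn⟩ : ∃ n, Nat.find hex = n + 1 :=
    Nat.exists_eq_succ_of_ne_zero fun h => (h ▸ Nat.find_spec hex) h₀
  have hout : ¬ InQuad m (v (n + 1)) := hn ▸ Nat.find_spec hex
  have hin : ∀ k ≤ n, InQuad m (v k) := fun k hk =>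
    not_not.1 (Nat.find_min hex (by omega))
  refine ⟨n + 2, ?_, ?_, ?_, ?_⟩
  · rw [List.Chain', List.isChain_iff_getElem]
    intro k hk
    simpa using hstep k
  · simp [List.range_succ_eq_map]
  · intro u hu
    rw [List.range_succ, List.map_append, List.map_singleton, List.dropLast_concat] at hu
    obtain ⟨k, hk, rfl⟩ := List.mem_map.1 hu
    exact hin k (by have := List.mem_range.1 hk; omega)
  · rw [List.range_succ, List.map_append, List.map_singleton, List.getLast?_concat]
    have hn' := hin n le_rfl
    unfold InQuad at hn' hout
    rcases hstep n with h | h <;> rw [h] at hout ⊢ <;> simp only at hout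
    · refine ⟨(v n).2, hn'.2.2.1, hn'.2.2.2, Or.inr ?_⟩
      rw [show (v n).1 = m by omega]
    · refine ⟨(v n).1, hn'.1, hn'.2.1, Or.inl ?_⟩
      rw [show (v n).2 = m by omega]

/-- Edges of a path cut out of an infinite walk are edges of the walk. -/
theorem exists_of_mem_pathEdges_map_range {v : ℕ → ℕ × ℕ} {n : ℕ}
    {e : (ℕ × ℕ) × (ℕ × ℕ)} (he : e ∈ pathEdges ((List.range n).map v)) :
    ∃ k, e = (v k, v (k + 1)) := by
  obtain ⟨k, hk, rfl⟩ := List.mem_iff_getElem.1 he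
  exact ⟨k, by simp [pathEdges]⟩

/-- A grid path from inside a set to outside of it traverses an edge leaving the set. -/
theorem exists_mem_pathEdges_leaving (P : ℕ × ℕ → Prop) (L : List (ℕ × ℕ)) {a b : ℕ × ℕ}
    (hL : L.IsChain GridStep) (ha : L.head? = some a) (hb : L.getLast? = some b)
    (hPa : P a) (hPb : ¬ P b) :
    ∃ e ∈ pathEdges L, GridStep e.1 e.2 ∧ P e.1 ∧ ¬ P e.2 := by
  induction L generalizing a with
  | nil => simp at ha
  | cons x L ih =>
    obtain rfl : x = a := by simpa using ha
    cases L with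
    | nil =>
      obtain rfl : x = b := by simpa using hb
      exact absurd hPa hPb
    | cons y L =>
      rw [List.isChain_cons_cons] at hL
      by_cases hy : P y
      · obtain ⟨e, he, h⟩ := ih hL.2 rfl (by simpa using hb) hy
        exact ⟨e, List.mem_cons_of_mem _ he, h⟩
      · exact ⟨(x, y), List.mem_cons_self, hL.1, hPa, hy⟩

/-- At most `x + y` edge-disjoint quadrant paths start in an `x × y` rectangle of the
quadrant. -/
theorem card_sources_le_of_disjoint_quadPaths {m : ℕ} {ι : Type*} [Fintype ι]
    {src : ι → ℕ × ℕ} {p : ι → List (ℕ × ℕ)} (hp : ∀ i, QuadPath m (src i) (p i))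
    (hdisj : ∀ i j, i ≠ j → ∀ e, e ∈ pathEdges (p i) → e ∉ pathEdges (p j))
    {x₁ x₂ y₁ y₂ : ℕ} (hx : x₁ ≤ x₂) (hxm : x₂ ≤ m) (hy : y₁ ≤ y₂) (hym : y₂ ≤ m) :
    (Finset.univ.filter fun i =>
      x₁ ≤ (src i).1 ∧ (src i).1 ≤ x₂ ∧ y₁ ≤ (src i).2 ∧ (src i).2 ≤ y₂).card ≤
        (x₂ - x₁ + 1) + (y₂ - y₁ + 1) := by
  classical
  let Z : ℕ × ℕ → Prop := fun u => x₁ ≤ u.1 ∧ u.1 ≤ x₂ ∧ y₁ ≤ u.2 ∧ u.2 ≤ y₂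
  have hleave : ∀ i, ∃ e, Z (src i) →
      e ∈ pathEdges (p i) ∧ GridStep e.1 e.2 ∧ Z e.1 ∧ ¬ Z e.2 := by
    intro i
    by_cases hi : Z (src i)
    · obtain ⟨hc, hh, -, j, -, -, hj | hj⟩ := hp i
      · obtain ⟨e, he⟩ := exists_mem_pathEdges_leaving Z (p i) hc hh hj hi
          (fun h => by have := h.2.2.2; simp only at this; omega)
        exact ⟨e, fun _ => he⟩
      · obtain ⟨e, he⟩ := exists_mem_pathEdges_leaving Z (p i) hc hh hj hi
          (fun h => by have := h.2.1; simp only at this; omega)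
        exact ⟨e, fun _ => he⟩
    · exact ⟨((0, 0), (0, 0)), fun h => absurd h hi⟩
  choose e he using hleave
  let T : Finset ((ℕ × ℕ) × (ℕ × ℕ)) :=
    (Finset.Icc x₁ x₂).image (fun c => ((c, y₂), (c, y₂ + 1))) ∪
      (Finset.Icc y₁ y₂).image (fun c => ((x₂, c), (x₂ + 1, c)))
  have hT : T.card ≤ (x₂ - x₁ + 1) + (y₂ - y₁ + 1) := by
    refine (Finset.card_union_le _ _).trans (add_le_add
      (Finset.card_image_le.trans ?_) (Finset.card_image_le.trans ?_)) <;>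
    · rw [Nat.card_Icc]
      omega
  refine le_trans (Finset.card_le_card_of_injOn e ?_ ?_) hT
  · intro i hi
    obtain ⟨-, hs, h₁, h₂⟩ := he i (by simpa using hi)
    generalize e i = d at hs h₁ h₂
    obtain ⟨⟨a, b⟩, w⟩ := d
    simp only [Z, GridStep] at hs h₁ h₂
    rcases hs with rfl | rfl <;> simp only at h₂
    · obtain rfl : a = x₂ := by omega
      exact Finset.mem_coe.2 (Finset.mem_union_right _
        (Finset.mem_image.2 ⟨b, Finset.mem_Icc.2 h₁.2.2, rfl⟩))
    · obtain rfl : b = y₂ := by omega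
      exact Finset.mem_coe.2 (Finset.mem_union_left _
        (Finset.mem_image.2 ⟨a, Finset.mem_Icc.2 ⟨h₁.1, h₁.2.1⟩, rfl⟩))
  · intro i hi j hj hij
    by_contra hne
    exact hdisj i j hne _ (he i (by simpa using hi)).1 (hij ▸ (he j (by simpa using hj)).1)

/-- **Quadrant feasibility.**  A finite family of requests with sources in the quadrant
`Q = {1, …, m} × {1, …, m}` (sources may repeat) can be routed along pairwise
edge-disjoint directed paths, each from its source across the top or right side of the
quadrant, if and only if for every axis-parallel rectangle `Z ⊆ Q` of width `x` and
height `y` the number of requests with source in `Z` is at most `x + y`. -/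
theorem quadrant_feasibility
    (m : ℕ) (hm : 0 < m)
    {ι : Type} [Fintype ι] [DecidableEq ι]
    (src : ι → ℕ × ℕ) (hsrc : ∀ i, InQuad m (src i)) :
    (∃ p : ι → List (ℕ × ℕ),
        (∀ i, QuadPath m (src i) (p i)) ∧
        (∀ i j, i ≠ j → ∀ e, e ∈ pathEdges (p i) → e ∉ pathEdges (p j))) ↔
      (∀ x₁ x₂ y₁ y₂ : ℕ, 1 ≤ x₁ → x₁ ≤ x₂ → x₂ ≤ m → 1 ≤ y₁ → y₁ ≤ y₂ → y₂ ≤ m →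
        (Finset.univ.filter fun i =>
            x₁ ≤ (src i).1 ∧ (src i).1 ≤ x₂ ∧ y₁ ≤ (src i).2 ∧ (src i).2 ≤ y₂).card ≤
          (x₂ - x₁ + 1) + (y₂ - y₁ + 1)) := by
  constructor
  · rintro ⟨p, hp, hdisj⟩ x₁ x₂ y₁ y₂ - hx hxm - hy hym
    exact card_sources_le_of_disjoint_quadPaths hp hdisj hx hxm hy hym
  · intro h
    have hrect : ∀ x₁ x₂ y₁ y₂ : ℕ, x₁ ≤ x₂ → y₁ ≤ y₂ →
        (Finset.univ.filter fun i =>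
          x₁ ≤ (src i).1 ∧ (src i).1 ≤ x₂ ∧ y₁ ≤ (src i).2 ∧ (src i).2 ≤ y₂).card ≤
            (x₂ - x₁ + 1) + (y₂ - y₁ + 1) := by
      intro x₁ x₂ y₁ y₂ hx hy
      rcases Finset.eq_empty_or_nonempty (Finset.univ.filter fun i =>
          x₁ ≤ (src i).1 ∧ (src i).1 ≤ x₂ ∧ y₁ ≤ (src i).2 ∧ (src i).2 ≤ y₂) with h₀ | ⟨i, hi⟩
      · simp [h₀]
      · have hi := (Finset.mem_filter.1 hi).2
        have hQ := hsrc i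
        unfold InQuad at hQ
        have hle := h (max x₁ 1) (min x₂ m) (max y₁ 1) (min y₂ m)
          (by omega) (by omega) (by omega) (by omega) (by omega) (by omega)
        refine le_trans (Finset.card_le_card fun j hj => ?_) (hle.trans (by omega))
        have hj := (Finset.mem_filter.1 hj).2
        have hQ := hsrc j
        unfold InQuad at hQ
        exact Finset.mem_filter.2 ⟨Finset.mem_univ j, by omega⟩
    obtain ⟨v, hv₀, hstep, hinj⟩ :=
      exists_disjoint_walks src (demand_le_card_cutEdges src hrect)
    have hpath : ∀ i, ∃ n, QuadPath m (src i) ((List.range n).map (v i)) := fun i =>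
      hv₀ i ▸ exists_quadPath_of_walk (v i) (hv₀ i ▸ hsrc i) (hstep i)
    choose n hn using hpath
    refine ⟨fun i => (List.range (n i)).map (v i), hn, fun i j hij e he he' => hij ?_⟩
    obtain ⟨k, rfl⟩ := exists_of_mem_pathEdges_map_range he
    obtain ⟨l, hl⟩ := exists_of_mem_pathEdges_map_range he'
    exact hinj i j k l (congrArg Prod.fst hl) (congrArg Prod.snd hl)
end
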